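/- arXiv:2406.02463 — 7 statements merged into one kernel-verified Lean document; each statement's English description precedes it below -/
import Mathlib

section
/- Let n be a natural number, let a, r : Fin n → ℝ be nonnegative, let ρ > 0, and let σ : Fin n → ℝ satisfy σ i > 0 for all i together with the privacy constraint ∑_{i} (r i)² / (σ i)² ≤ 2ρ. Then ∑_{i} a i · (σ i)² ≥ (∑_{i} √(a i) · r i)² / (2ρ). -/
open Finset

theorem cauchy_schwarz_variance_lower_bound (n : ℕ) (a r : Fin n → ℝ)
    (ha : ∀ i, 0 ≤ a i) (hr : ∀ i, 0 ≤ r i) (ρ : ℝ) (hρ : 0 < ρ)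
    (σ : Fin n → ℝ) (hσ : ∀ i, 0 < σ i)
    (hbudget : ∑ i, (r i) ^ 2 / (σ i) ^ 2 ≤ 2 * ρ) :
    (∑ i, Real.sqrt (a i) * r i) ^ 2 / (2 * ρ) ≤ ∑ i, a i * (σ i) ^ 2 := by
  have h0 : 0 ≤ ∑ i, a i * (σ i) ^ 2 :=
    Finset.sum_nonneg fun i _ => mul_nonneg (ha i) (sq_nonneg _)
  have key : (∑ i, Real.sqrt (a i) * r i) ^ 2 ≤
      (∑ i, a i * (σ i) ^ 2) * ∑ i, (r i) ^ 2 / (σ i) ^ 2 := by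
    apply Finset.sum_sq_le_sum_mul_sum_of_sq_eq_mul
    · intro i _
      exact mul_nonneg (ha i) (sq_nonneg _)
    · intro i _
      positivity
    · intro i _
      have h := (hσ i).ne'
      rw [mul_pow, Real.sq_sqrt (ha i)]
      field_simp
  rw [div_le_iff₀ (by positivity)]
  exact key.trans (mul_le_mul_of_nonneg_left hbudget h0)
end

section
/- Let O be a nonempty finite type, let ε > 0 and Δ > 0, and let u, u' : O → ℝ satisfy |u o − u' o| ≤ Δ for every o : O. Then for every o : O, exp(ε · u o / (2Δ)) / (∑_{o'} exp(ε · u o' / (2Δ))) ≤ exp(ε) · (exp(ε · u' o / (2Δ)) / (∑_{o'} exp(ε · u' o' / (2Δ)))). -/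
open Finset Real

theorem exponential_mechanism_dp (O : Type*) [Fintype O] [Nonempty O]
    (ε Δ : ℝ) (hε : 0 < ε) (hΔ : 0 < Δ)
    (u u' : O → ℝ) (hsens : ∀ o, |u o - u' o| ≤ Δ) (o : O) :
    Real.exp (ε * u o / (2 * Δ)) / (∑ o', Real.exp (ε * u o' / (2 * Δ))) ≤
      Real.exp ε *
        (Real.exp (ε * u' o / (2 * Δ)) /
          (∑ o', Real.exp (ε * u' o' / (2 * Δ)))) := by
  have key : ∀ a b : ℝ, a - b ≤ Δ →
      Real.exp (ε * a / (2 * Δ)) ≤ Real.exp (ε / 2) * Real.exp (ε * b / (2 * Δ)) := by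
    intro a b hab
    rw [← Real.exp_add, Real.exp_le_exp]
    have h : ε / 2 + ε * b / (2 * Δ) = ε * (Δ + b) / (2 * Δ) := by
      field_simp
    rw [h]
    have h2 : a ≤ Δ + b := by linarith
    gcongr
  have h1 := key (u o) (u' o) (abs_le.mp (hsens o)).2
  have h2 : (∑ o', Real.exp (ε * u' o' / (2 * Δ))) ≤
      Real.exp (ε / 2) * ∑ o', Real.exp (ε * u o' / (2 * Δ)) := by
    rw [Finset.mul_sum]
    refine Finset.sum_le_sum fun i _ => key _ _ ?_
    have := (abs_le.mp (hsens i)).1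
    linarith
  have p1 : 0 < ∑ o', Real.exp (ε * u o' / (2 * Δ)) :=
    Finset.sum_pos (fun _ _ => Real.exp_pos _) Finset.univ_nonempty
  have p2 : 0 < ∑ o', Real.exp (ε * u' o' / (2 * Δ)) :=
    Finset.sum_pos (fun _ _ => Real.exp_pos _) Finset.univ_nonempty
  have he : Real.exp ε = Real.exp (ε / 2) * Real.exp (ε / 2) := by
    rw [← Real.exp_add]; congr 1; ring
  rw [← mul_div_assoc, div_le_div_iff₀ p1 p2, he]
  calc _ ≤ (Real.exp (ε / 2) * Real.exp (ε * u' o / (2 * Δ))) *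
        (Real.exp (ε / 2) * ∑ o', Real.exp (ε * u o' / (2 * Δ))) :=
        mul_le_mul h1 h2 p2.le (by positivity)
    _ = _ := by ring
end

section
/- Let μ₁, μ₂ : ℝ, let σ > 0, and let α > 1. Let P = gaussianReal μ₁ σ² and Q = gaussianReal μ₂ σ². Then P is absolutely continuous with respect to Q, and ∫ (dP/dQ)^α dQ = exp(α · (α − 1) · (μ₁ − μ₂)² / (2σ²)); equivalently, the Rényi divergence of order α satisfies (1/(α−1)) · log ∫ (dP/dQ)^α dQ = α · (μ₁ − μ₂)² / (2σ²). -/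
open MeasureTheory ProbabilityTheory

lemma gaussian_eq_withDensity (a b : ℝ) (v : NNReal) (hv : v ≠ 0) :
    gaussianReal a v = (gaussianReal b v).withDensity
      (fun x => ENNReal.ofReal
        (Real.exp ((a - b) / v * x + (b ^ 2 - a ^ 2) / (2 * v)))) := by
  rw [gaussianReal_of_var_ne_zero _ hv, gaussianReal_of_var_ne_zero _ hv,
    ← withDensity_mul _ (measurable_gaussianPDF b v) (by fun_prop)]
  congr 1
  ext x
  have hv' : (v : ℝ) ≠ 0 := by exact_mod_cast hv
  rw [Pi.mul_apply, gaussianPDF_def, gaussianPDF_def]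
  simp only
  rw [← ENNReal.ofReal_mul (gaussianPDFReal_nonneg _ _ _)]
  congr 1
  simp only [gaussianPDFReal_def]
  rw [mul_assoc (√(2 * Real.pi * (v : ℝ)))⁻¹, ← Real.exp_add]
  congr 2
  field_simp
  ring

lemma gaussian_renyi_integral (a b : ℝ) (v : NNReal) (hv : v ≠ 0) (α : ℝ) :
    (∫ x, ((gaussianReal a v).rnDeriv (gaussianReal b v) x).toReal ^ α ∂(gaussianReal b v)) =
      Real.exp (α * (α - 1) * (a - b) ^ 2 / (2 * v)) := by
  have hv' : (v : ℝ) ≠ 0 := by exact_mod_cast hv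
  have hd : (gaussianReal a v).rnDeriv (gaussianReal b v) =ᵐ[gaussianReal b v]
      (fun x => ENNReal.ofReal
        (Real.exp ((a - b) / v * x + (b ^ 2 - a ^ 2) / (2 * v)))) := by
    rw [gaussian_eq_withDensity a b v hv]
    exact Measure.rnDeriv_withDensity _ (by fun_prop)
  have h1 : (∫ x, ((gaussianReal a v).rnDeriv (gaussianReal b v) x).toReal ^ α
      ∂(gaussianReal b v)) =
      ∫ x, Real.exp (α * ((b ^ 2 - a ^ 2) / (2 * v))) * Real.exp ((α * ((a - b) / v)) * x)
        ∂(gaussianReal b v) := by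
    apply integral_congr_ae
    filter_upwards [hd] with x hx
    rw [hx, ENNReal.toReal_ofReal (Real.exp_pos _).le, ← Real.exp_mul, ← Real.exp_add]
    congr 1
    ring
  have h2 := congrFun (mgf_id_gaussianReal (μ := b) (v := v)) (α * ((a - b) / v))
  simp only [mgf, id] at h2
  rw [h1, integral_const_mul, h2, ← Real.exp_add]
  congr 1
  field_simp
  ring

theorem gaussian_renyi_divergence (μ₁ μ₂ : ℝ) (σ : ℝ) (hσ : 0 < σ)
    (α : ℝ) (hα : 1 < α) :
    gaussianReal μ₁ (σ ^ 2).toNNReal ≪ gaussianReal μ₂ (σ ^ 2).toNNReal ∧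
    (∫ x, ((gaussianReal μ₁ (σ ^ 2).toNNReal).rnDeriv
        (gaussianReal μ₂ (σ ^ 2).toNNReal) x).toReal ^ α
        ∂(gaussianReal μ₂ (σ ^ 2).toNNReal)) =
      Real.exp (α * (α - 1) * (μ₁ - μ₂) ^ 2 / (2 * σ ^ 2)) ∧
    (1 / (α - 1)) * Real.log
        (∫ x, ((gaussianReal μ₁ (σ ^ 2).toNNReal).rnDeriv
          (gaussianReal μ₂ (σ ^ 2).toNNReal) x).toReal ^ α
          ∂(gaussianReal μ₂ (σ ^ 2).toNNReal)) =
      α * (μ₁ - μ₂) ^ 2 / (2 * σ ^ 2) := by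
  have hv : (σ ^ 2).toNNReal ≠ 0 := by
    have : 0 < σ ^ 2 := by positivity
    exact (Real.toNNReal_pos.mpr this).ne'
  have hc : ((σ ^ 2).toNNReal : ℝ) = σ ^ 2 := Real.coe_toNNReal _ (by positivity)
  have hI := gaussian_renyi_integral μ₁ μ₂ _ hv α
  rw [hc] at hI
  refine ⟨?_, hI, ?_⟩
  · rw [gaussian_eq_withDensity μ₁ μ₂ _ hv]
    exact withDensity_absolutelyContinuous _ _
  · rw [hI, Real.log_exp]
    have : α - 1 ≠ 0 := by linarith
    field_simp
end

section
/- Let n be a natural number, let μ, μ' : Fin n → ℝ, let σ > 0, and let α > 1. Let P be the product measure Measure.pi (fun i => gaussianReal (μ i) σ²) and Q = Measure.pi (fun i => gaussianReal (μ' i) σ²). Then P is absolutely continuous with respect to Q, and ∫ (dP/dQ)^α dQ = exp(α · (α − 1) · (∑_{i} (μ i − μ' i)²) / (2σ²)). In particular, if ‖μ − μ'‖₂ ≤ Δ then (1/(α−1)) · log ∫ (dP/dQ)^α dQ ≤ α · Δ² / (2σ²). -/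
open MeasureTheory ProbabilityTheory Finset

open scoped NNReal ENNReal

/-- likelihood ratio of two Gaussians with common variance -/
noncomputable def gaussLR (a b v : ℝ) (x : ℝ) : ℝ :=
  Real.exp ((a - b) / v * x + (b ^ 2 - a ^ 2) / (2 * v))

lemma measurable_gaussLR (a b v : ℝ) : Measurable (gaussLR a b v) := by
  unfold gaussLR; fun_prop

lemma gaussianReal_eq_withDensity (a b : ℝ) (v : ℝ≥0) (hv : v ≠ 0) :
    gaussianReal a v =
      (gaussianReal b v).withDensity (fun x => ENNReal.ofReal (gaussLR a b v x)) := by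
  have hv' : (v : ℝ) ≠ 0 := by exact_mod_cast hv
  rw [gaussianReal_of_var_ne_zero a hv, gaussianReal_of_var_ne_zero b hv,
    ← withDensity_mul _ (measurable_gaussianPDF b v) (measurable_gaussLR a b v).ennreal_ofReal]
  congr 1
  ext x
  simp only [Pi.mul_apply, gaussianPDF]
  rw [← ENNReal.ofReal_mul (gaussianPDFReal_nonneg _ _ _)]
  congr 1
  simp only [gaussianPDFReal, gaussLR]
  rw [mul_assoc (√(2 * Real.pi * v))⁻¹, ← Real.exp_add]
  congr 2
  field_simp
  ring

lemma integral_gaussLR_rpow (a b α : ℝ) (v : ℝ≥0) (hv : v ≠ 0) :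
    ∫ x, gaussLR a b v x ^ α ∂(gaussianReal b v) =
      Real.exp (α * (α - 1) * (a - b) ^ 2 / (2 * v)) := by
  have hv' : (v : ℝ) ≠ 0 := by exact_mod_cast hv
  have h : ∀ x, gaussLR a b v x ^ α =
      Real.exp (α * ((a - b) / v) * x) * Real.exp (α * ((b ^ 2 - a ^ 2) / (2 * v))) := by
    intro x
    rw [gaussLR, ← Real.exp_mul, ← Real.exp_add]
    congr 1
    ring
  simp_rw [h]
  rw [integral_mul_const]
  have := congrFun (mgf_id_gaussianReal (μ := b) (v := v)) (α * ((a - b) / v))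
  simp only [mgf, id] at this
  rw [this, ← Real.exp_add]
  congr 1
  field_simp
  ring

lemma lintegral_pi_prod {n : ℕ} (ν : Fin n → Measure ℝ) [∀ i, IsProbabilityMeasure (ν i)]
    (f : Fin n → ℝ → ℝ≥0∞) (hf : ∀ i, Measurable (f i)) :
    ∫⁻ x, ∏ i, f i (x i) ∂(Measure.pi ν) = ∏ i, ∫⁻ x, f i x ∂(ν i) := by
  have hi : iIndepFun (fun i (x : Fin n → ℝ) => f i (x i)) (Measure.pi ν) :=
    iIndepFun_pi (fun i => (hf i).aemeasurable)
  have := lintegral_prod_eq_prod_lintegral_of_indepFun (μ := Measure.pi ν) Finset.univ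
    (fun i (x : Fin n → ℝ) => f i (x i)) hi (fun i => (hf i).comp (measurable_pi_apply i))
  rw [this]
  refine Finset.prod_congr rfl fun i _ => ?_
  exact (measurePreserving_eval ν i).lintegral_comp (hf i)

lemma pi_eq_withDensity {n : ℕ} (ν ν' : Fin n → Measure ℝ) [∀ i, IsProbabilityMeasure (ν i)]
    [∀ i, IsProbabilityMeasure (ν' i)]
    (f : Fin n → ℝ → ℝ≥0∞) (hf : ∀ i, Measurable (f i))
    (h : ∀ i, ν i = (ν' i).withDensity (f i)) :
    Measure.pi ν = (Measure.pi ν').withDensity (fun x => ∏ i, f i (x i)) := by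
  refine Measure.pi_eq (fun s hs => ?_)
  rw [withDensity_apply _ (MeasurableSet.univ_pi hs), ← lintegral_indicator (MeasurableSet.univ_pi hs)]
  have : ∀ x : Fin n → ℝ, (Set.univ.pi s).indicator (fun x => ∏ i, f i (x i)) x =
      ∏ i, (s i).indicator (f i) (x i) := by
    intro x
    by_cases hx : x ∈ Set.univ.pi s
    · rw [Set.indicator_of_mem hx]
      exact Finset.prod_congr rfl fun i _ =>
        (Set.indicator_of_mem (hx i (Set.mem_univ i)) _).symm
    · rw [Set.indicator_of_notMem hx]
      simp only [Set.mem_pi, Set.mem_univ, true_imp_iff, not_forall] at hx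
      obtain ⟨i, hi⟩ := hx
      exact (Finset.prod_eq_zero (Finset.mem_univ i) (Set.indicator_of_notMem hi _)).symm
  simp_rw [this]
  rw [lintegral_pi_prod ν' _ (fun i => (hf i).indicator (hs i))]
  refine Finset.prod_congr rfl fun i _ => ?_
  rw [lintegral_indicator (hs i), h i, withDensity_apply _ (hs i)]

theorem gaussian_mechanism_zCDP (n : ℕ) (μ μ' : Fin n → ℝ) (σ : ℝ) (hσ : 0 < σ)
    (α : ℝ) (hα : 1 < α) :
    (Measure.pi fun i => gaussianReal (μ i) (σ ^ 2).toNNReal) ≪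
      (Measure.pi fun i => gaussianReal (μ' i) (σ ^ 2).toNNReal) ∧
    (∫ x, ((Measure.pi fun i => gaussianReal (μ i) (σ ^ 2).toNNReal).rnDeriv
        (Measure.pi fun i => gaussianReal (μ' i) (σ ^ 2).toNNReal) x).toReal ^ α
        ∂(Measure.pi fun i => gaussianReal (μ' i) (σ ^ 2).toNNReal)) =
      Real.exp (α * (α - 1) * (∑ i, (μ i - μ' i) ^ 2) / (2 * σ ^ 2)) ∧
    ∀ Δ : ℝ, Real.sqrt (∑ i, (μ i - μ' i) ^ 2) ≤ Δ →
      (1 / (α - 1)) * Real.log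
        (∫ x, ((Measure.pi fun i => gaussianReal (μ i) (σ ^ 2).toNNReal).rnDeriv
          (Measure.pi fun i => gaussianReal (μ' i) (σ ^ 2).toNNReal) x).toReal ^ α
          ∂(Measure.pi fun i => gaussianReal (μ' i) (σ ^ 2).toNNReal)) ≤
      α * Δ ^ 2 / (2 * σ ^ 2) := by
  have hv : (σ ^ 2).toNNReal ≠ 0 := by
    have : 0 < σ ^ 2 := by positivity
    simpa using hσ.ne'
  have hvc : (((σ ^ 2).toNNReal : ℝ≥0) : ℝ) = σ ^ 2 := Real.coe_toNNReal _ (by positivity)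
  have hf : ∀ i, Measurable
      (fun x => ENNReal.ofReal (gaussLR (μ i) (μ' i) (σ ^ 2).toNNReal x)) :=
    fun i => (measurable_gaussLR _ _ _).ennreal_ofReal
  have hP := pi_eq_withDensity (fun i => gaussianReal (μ i) (σ ^ 2).toNNReal)
    (fun i => gaussianReal (μ' i) (σ ^ 2).toNNReal) _ hf
    (fun i => gaussianReal_eq_withDensity (μ i) (μ' i) _ hv)
  have hI : (∫ x, ((Measure.pi fun i => gaussianReal (μ i) (σ ^ 2).toNNReal).rnDeriv
        (Measure.pi fun i => gaussianReal (μ' i) (σ ^ 2).toNNReal) x).toReal ^ α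
        ∂(Measure.pi fun i => gaussianReal (μ' i) (σ ^ 2).toNNReal)) =
      Real.exp (α * (α - 1) * (∑ i, (μ i - μ' i) ^ 2) / (2 * σ ^ 2)) := by
    have hm : Measurable (fun x : Fin n → ℝ =>
        ∏ i, ENNReal.ofReal (gaussLR (μ i) (μ' i) (σ ^ 2).toNNReal (x i))) :=
      Finset.measurable_prod _ (fun i _ => (hf i).comp (measurable_pi_apply i))
    have hr := Measure.rnDeriv_withDensity
      (Measure.pi fun i => gaussianReal (μ' i) (σ ^ 2).toNNReal) hm
    rw [← hP] at hr
    have h1 : (fun x => ((Measure.pi fun i => gaussianReal (μ i) (σ ^ 2).toNNReal).rnDeriv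
        (Measure.pi fun i => gaussianReal (μ' i) (σ ^ 2).toNNReal) x).toReal ^ α)
        =ᵐ[Measure.pi fun i => gaussianReal (μ' i) (σ ^ 2).toNNReal]
        fun x => ∏ i, gaussLR (μ i) (μ' i) (σ ^ 2).toNNReal (x i) ^ α := by
      filter_upwards [hr] with x hx
      have h0 : ∀ i, 0 ≤ gaussLR (μ i) (μ' i) (σ ^ 2).toNNReal (x i) :=
        fun i => (Real.exp_pos _).le
      rw [hx, ENNReal.toReal_prod, Real.finsetProd_rpow _ _ (fun i _ => h0 i)]
      congr 1
      exact Finset.prod_congr rfl fun i _ => ENNReal.toReal_ofReal (h0 i)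
    rw [integral_congr_ae h1, integral_fintype_prod_eq_prod
      (fun i x => gaussLR (μ i) (μ' i) (σ ^ 2).toNNReal x ^ α)]
    simp_rw [integral_gaussLR_rpow _ _ α _ hv]
    rw [← Real.exp_sum, hvc, Finset.mul_sum, Finset.sum_div]
  refine ⟨?_, hI, ?_⟩
  · rw [hP]
    exact withDensity_absolutelyContinuous _ _
  · intro Δ hΔ
    rw [hI, Real.log_exp]
    have hs : ∑ i, (μ i - μ' i) ^ 2 ≤ Δ ^ 2 := (Real.sqrt_le_left
      ((Real.sqrt_nonneg _).trans hΔ)).1 hΔ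
    have ha : α - 1 ≠ 0 := by linarith
    have : 1 / (α - 1) * (α * (α - 1) * (∑ i, (μ i - μ' i) ^ 2) / (2 * σ ^ 2)) =
        α * (∑ i, (μ i - μ' i) ^ 2) / (2 * σ ^ 2) := by
      field_simp
    rw [this]
    have : 0 ≤ α := by linarith
    gcongr
end

section
/- Let P and Q be probability measures on a measurable space that are mutually absolutely continuous, let ε > 0, and suppose exp(−ε) ≤ dP/dQ ≤ exp(ε) holds Q-almost everywhere. Then for every α > 1, ∫ (dP/dQ)^α dQ ≤ exp(α · (α − 1) · ρ), where ρ = ε · (exp(ε) − 1) / (exp(ε) + 1); equivalently, the Rényi divergence of order α between P and Q is at most ρ·α. -/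
open MeasureTheory

lemma aux_tanh_anti : AntitoneOn (fun u : ℝ => Real.sinh u / (u * Real.cosh u)) (Set.Ioi 0) := by
  have hd : ∀ u : ℝ, 0 < u → HasDerivAt (fun u : ℝ => Real.sinh u / (u * Real.cosh u))
      ((Real.cosh u * (u * Real.cosh u) - Real.sinh u * (1 * Real.cosh u + u * Real.sinh u))
        / (u * Real.cosh u) ^ 2) u := by
    intro u hu
    exact (Real.hasDerivAt_sinh u).div ((hasDerivAt_id u).mul (Real.hasDerivAt_cosh u))
      (mul_pos hu (Real.cosh_pos u)).ne'
  apply antitoneOn_of_deriv_nonpos (convex_Ioi 0)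
  · intro u hu
    exact (hd u hu).continuousAt.continuousWithinAt
  · intro u hu
    rw [interior_Ioi] at hu
    exact (hd u hu).differentiableAt.differentiableWithinAt
  · intro u hu
    rw [interior_Ioi] at hu
    rw [(hd u hu).deriv]
    apply div_nonpos_of_nonpos_of_nonneg _ (sq_nonneg _)
    have h1 : 2 * u ≤ Real.sinh (2 * u) := by
      rw [Real.self_le_sinh_iff]
      have : (0:ℝ) < u := hu
      linarith
    rw [Real.sinh_two_mul] at h1
    have h2 := Real.cosh_sq u
    have h3 : Real.cosh u * (u * Real.cosh u) -
        Real.sinh u * (1 * Real.cosh u + u * Real.sinh u)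
        = u * (Real.cosh u ^ 2 - Real.sinh u ^ 2) - Real.sinh u * Real.cosh u := by ring
    rw [h3, h2]
    linarith

lemma aux_cosh (u v : ℝ) (hv : 0 < v) (huv : v ≤ u) :
    Real.cosh u / Real.cosh v ≤
      Real.exp ((u ^ 2 - v ^ 2) * (Real.sinh v / (v * Real.cosh v) / 2)) := by
  set c := Real.sinh v / (v * Real.cosh v) / 2 with hc
  have hd : ∀ t : ℝ, HasDerivAt (fun t : ℝ => Real.cosh t * Real.exp (-c * t ^ 2))
      (Real.sinh t * Real.exp (-c * t ^ 2)
        + Real.cosh t * (Real.exp (-c * t ^ 2) * (-c * (2 * t)))) t := by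
    intro t
    have h1 : HasDerivAt (fun t : ℝ => -c * t ^ 2) (-c * (2 * t)) t := by
      simpa using (hasDerivAt_pow 2 t).const_mul (-c)
    exact (Real.hasDerivAt_cosh t).mul h1.exp
  have hanti : AntitoneOn (fun t : ℝ => Real.cosh t * Real.exp (-c * t ^ 2)) (Set.Ici v) := by
    apply antitoneOn_of_deriv_nonpos (convex_Ici v)
    · intro t _
      exact (hd t).continuousAt.continuousWithinAt
    · intro t _
      exact (hd t).differentiableAt.differentiableWithinAt
    · intro t ht
      rw [interior_Ici] at ht
      have ht' : v < t := ht
      have ht0 : 0 < t := hv.trans ht'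
      rw [(hd t).deriv]
      have h := aux_tanh_anti (Set.mem_Ioi.2 hv) (Set.mem_Ioi.2 ht0) ht'.le
      simp only at h
      have h2 : Real.sinh v / (v * Real.cosh v) = 2 * c := by rw [hc]; ring
      rw [h2, div_le_iff₀ (mul_pos ht0 (Real.cosh_pos t))] at h
      have h3 : Real.sinh t * Real.exp (-c * t ^ 2)
        + Real.cosh t * (Real.exp (-c * t ^ 2) * (-c * (2 * t)))
        = Real.exp (-c * t ^ 2) * (Real.sinh t - 2 * c * (t * Real.cosh t)) := by ring
      rw [h3]
      exact mul_nonpos_of_nonneg_of_nonpos (Real.exp_pos _).le (by linarith)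
  have h := hanti (Set.mem_Ici.2 le_rfl) (Set.mem_Ici.2 huv) huv
  simp only at h
  rw [div_le_iff₀ (Real.cosh_pos v)]
  have h4 : Real.exp ((u ^ 2 - v ^ 2) * c) = Real.exp (-c * v ^ 2) * Real.exp (c * u ^ 2) := by
    rw [← Real.exp_add]; congr 1; ring
  have h5 : Real.exp (-c * u ^ 2) * Real.exp (c * u ^ 2) = 1 := by
    rw [← Real.exp_add, ← Real.exp_zero]; congr 1; ring
  have h6 := mul_le_mul_of_nonneg_right h (Real.exp_pos (c * u ^ 2)).le
  rw [mul_assoc, h5, mul_one] at h6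
  rw [h4]
  linarith

lemma aux_final (ε α : ℝ) (hε : 0 < ε) (hα : 1 < α) :
    (Real.exp ε * Real.exp (-ε * α) + Real.exp (ε * α)) / (Real.exp ε + 1) ≤
      Real.exp (α * (α - 1) * (ε * (Real.exp ε - 1) / (Real.exp ε + 1))) := by
  have h := aux_cosh ((α - 1 / 2) * ε) (ε / 2) (by linarith) (by nlinarith)
  have hE : Real.exp ε = Real.exp (ε / 2) * Real.exp (ε / 2) := by
    rw [← Real.exp_add]; congr 1; ring
  have hs : 0 < Real.exp (ε / 2) := Real.exp_pos _
  have hu1 : Real.exp (ε * α) = Real.exp ((α - 1 / 2) * ε) * Real.exp (ε / 2) := by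
    rw [← Real.exp_add]; congr 1; ring
  have hu2 : Real.exp ε * Real.exp (-ε * α)
      = Real.exp (-((α - 1 / 2) * ε)) * Real.exp (ε / 2) := by
    rw [← Real.exp_add, ← Real.exp_add]; congr 1; ring
  have hL : Real.cosh ((α - 1 / 2) * ε) / Real.cosh (ε / 2)
      = (Real.exp ε * Real.exp (-ε * α) + Real.exp (ε * α)) / (Real.exp ε + 1) := by
    rw [hu1, hu2, hE, Real.cosh_eq, Real.cosh_eq, Real.exp_neg (ε / 2)]
    field_simp
    ring
  have hR : Real.sinh (ε / 2) / (ε / 2 * Real.cosh (ε / 2)) / 2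
      = (Real.exp ε - 1) / (Real.exp ε + 1) / ε := by
    rw [hE, Real.cosh_eq, Real.sinh_eq, Real.exp_neg (ε / 2)]
    field_simp
  rw [hL, hR] at h
  refine h.trans_eq ?_
  congr 1
  have : Real.exp ε + 1 ≠ 0 := by positivity
  field_simp
  ring

theorem pure_dp_to_zCDP (X : Type*) [MeasurableSpace X]
    (P Q : Measure X) [IsProbabilityMeasure P] [IsProbabilityMeasure Q]
    (hPQ : P ≪ Q) (hQP : Q ≪ P) (ε : ℝ) (hε : 0 < ε)
    (hratio : ∀ᵐ x ∂Q, Real.exp (-ε) ≤ (P.rnDeriv Q x).toReal ∧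
      (P.rnDeriv Q x).toReal ≤ Real.exp ε) :
    ∀ α : ℝ, 1 < α →
      (∫ x, (P.rnDeriv Q x).toReal ^ α ∂Q) ≤
        Real.exp (α * (α - 1) * (ε * (Real.exp ε - 1) / (Real.exp ε + 1))) := by
  intro α hα
  refine le_trans ?_ (aux_final ε α hε hα)
  have hE1 : 1 < Real.exp ε := Real.one_lt_exp_iff.2 hε
  have hAE : Real.exp (-ε) < Real.exp ε := Real.exp_lt_exp.2 (by linarith)
  have hint : Integrable (fun x => (P.rnDeriv Q x).toReal) Q :=
    Measure.integrable_toReal_rnDeriv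
  have hone : ∫ x, (P.rnDeriv Q x).toReal ∂Q = 1 := by
    rw [Measure.integral_toReal_rnDeriv hPQ]; simp
  set D := Real.exp ε - Real.exp (-ε) with hD
  have hDpos : 0 < D := by linarith
  set a := Real.exp (-ε * α) with ha
  set b := Real.exp (ε * α) with hb
  have hI : Integrable (fun x => (Real.exp ε * a - Real.exp (-ε) * b) / D
      + (b - a) / D * (P.rnDeriv Q x).toReal) Q :=
    (integrable_const _).add (hint.const_mul _)
  calc (∫ x, (P.rnDeriv Q x).toReal ^ α ∂Q)
      ≤ ∫ x, ((Real.exp ε * a - Real.exp (-ε) * b) / D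
          + (b - a) / D * (P.rnDeriv Q x).toReal) ∂Q := by
        apply integral_mono_of_nonneg
        · exact Filter.Eventually.of_forall fun x => Real.rpow_nonneg ENNReal.toReal_nonneg _
        · exact hI
        · filter_upwards [hratio] with x hx
          set y := (P.rnDeriv Q x).toReal
          have hc := (convexOn_rpow hα.le).2 (Set.mem_Ici.2 (Real.exp_pos (-ε)).le)
            (Set.mem_Ici.2 (Real.exp_pos ε).le)
            (div_nonneg (sub_nonneg.2 hx.2) hDpos.le)
            (div_nonneg (sub_nonneg.2 hx.1) hDpos.le)
            (by rw [← add_div, div_eq_one_iff_eq hDpos.ne']; rw [hD]; ring)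
          simp only [smul_eq_mul, ← Real.exp_mul] at hc
          have e1 : (Real.exp ε - y) / D * Real.exp (-ε) + (y - Real.exp (-ε)) / D * Real.exp ε
              = y := by
            field_simp
            rw [hD]; ring
          rw [e1] at hc
          refine hc.trans_eq ?_
          rw [← ha, ← hb]
          ring
    _ = (Real.exp ε * a - Real.exp (-ε) * b) / D + (b - a) / D := by
        rw [integral_add (integrable_const _) (hint.const_mul _), integral_const_mul, hone]
        simp
    _ ≤ _ := by
        apply le_of_eq
        rw [← add_div, div_eq_div_iff hDpos.ne' (by positivity), hD]
        have h : Real.exp ε * Real.exp (-ε) = 1 := by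
          rw [← Real.exp_add]; simp
        linear_combination (a - b) * h + (Real.exp ε * 0) * h
end

section
/- Let n be a natural number, let σ : Fin n → ℝ satisfy σ i > 0 for all i, let r : Fin n → ℝ be nonnegative, and let x, x' : Fin n → ℝ satisfy |x i − x' i| ≤ r i for every i. Let ρ₁ = (1/2) · ∑_{i} (r i)²/(σ i)². Let P = Measure.pi (fun i => gaussianReal (x i / σ i) 1) and Q = Measure.pi (fun i => gaussianReal (x' i / σ i) 1). Then P is absolutely continuous with respect to Q, and for every α > 1, ∫ (dP/dQ)^α dQ ≤ exp(ρ₁ · α · (α − 1)). -/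
open MeasureTheory ProbabilityTheory Finset

lemma aux_one (a b : ℝ) : gaussianReal a 1 = (gaussianReal b 1).withDensity
    (fun z => ENNReal.ofReal (Real.exp ((a - b) * z - (a ^ 2 - b ^ 2) / 2))) := by
  rw [gaussianReal_of_var_ne_zero _ one_ne_zero, gaussianReal_of_var_ne_zero _ one_ne_zero,
    ← withDensity_mul _ (measurable_gaussianPDF _ _) (by fun_prop)]
  congr 1
  ext z
  simp only [gaussianPDF, Pi.mul_apply]
  rw [← ENNReal.ofReal_mul (gaussianPDFReal_nonneg _ _ _)]
  congr 1
  simp only [gaussianPDFReal]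
  rw [mul_assoc _ (Real.exp _) (Real.exp _), ← Real.exp_add]
  congr 2
  push_cast
  ring

lemma aux_int (a b : ℝ) : Integrable
    (fun z => Real.exp ((a - b) * z - (a ^ 2 - b ^ 2) / 2)) (gaussianReal b 1) := by
  simp only [Real.exp_sub]
  exact (integrable_exp_mul_gaussianReal _).div_const _

lemma aux_pi (n : ℕ) (a b : Fin n → ℝ) :
    (Measure.pi fun i => gaussianReal (a i) 1) =
    (Measure.pi fun i => gaussianReal (b i) 1).withDensity
    (fun z => ENNReal.ofReal
      (∏ i, Real.exp ((a i - b i) * z i - ((a i) ^ 2 - (b i) ^ 2) / 2))) := by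
  refine Measure.pi_eq fun s hs => ?_
  rw [withDensity_apply _ (MeasurableSet.univ_pi hs), Measure.restrict_pi_pi,
    ← ofReal_integral_eq_lintegral_ofReal]
  · rw [integral_fintype_prod_eq_prod
      (f := fun i z => Real.exp ((a i - b i) * z - ((a i) ^ 2 - (b i) ^ 2) / 2)),
      ENNReal.ofReal_prod_of_nonneg (fun i _ => integral_nonneg fun _ => (Real.exp_pos _).le)]
    refine Finset.prod_congr rfl fun i _ => ?_
    rw [aux_one (a i) (b i), withDensity_apply _ (hs i), ofReal_integral_eq_lintegral_ofReal]
    · exact (aux_int _ _).restrict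
    · exact ae_of_all _ fun _ => (Real.exp_pos _).le
  · exact Integrable.fintype_prod_dep
      (f := fun i z => Real.exp ((a i - b i) * z - ((a i) ^ 2 - (b i) ^ 2) / 2))
      fun i => (aux_int _ _).restrict
  · exact ae_of_all _ fun _ => Finset.prod_nonneg fun _ _ => (Real.exp_pos _).le

lemma aux_mom (a b α : ℝ) :
    ∫ z, Real.exp ((a - b) * z - (a ^ 2 - b ^ 2) / 2) ^ α ∂(gaussianReal b 1) =
      Real.exp ((a - b) ^ 2 / 2 * α * (α - 1)) := by
  have h : ∀ z : ℝ, Real.exp ((a - b) * z - (a ^ 2 - b ^ 2) / 2) ^ α =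
      Real.exp (((a - b) * α) * z) * Real.exp (- (a ^ 2 - b ^ 2) / 2 * α) := by
    intro z
    rw [← Real.exp_mul, ← Real.exp_add]
    congr 1
    ring
  have h2 := congrFun (mgf_id_gaussianReal (μ := b) (v := 1)) ((a - b) * α)
  simp only [mgf, id] at h2
  simp_rw [h]
  rw [integral_mul_const, h2, ← Real.exp_add]
  congr 1
  push_cast
  ring

theorem adsbpc_single_publisher_zCDP (n : ℕ) (σ : Fin n → ℝ) (hσ : ∀ i, 0 < σ i)
    (r : Fin n → ℝ) (hr : ∀ i, 0 ≤ r i)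
    (x x' : Fin n → ℝ) (hneighbor : ∀ i, |x i - x' i| ≤ r i) :
    (Measure.pi fun i => gaussianReal (x i / σ i) 1) ≪
      (Measure.pi fun i => gaussianReal (x' i / σ i) 1) ∧
    ∀ α : ℝ, 1 < α →
      (∫ z, ((Measure.pi fun i => gaussianReal (x i / σ i) 1).rnDeriv
          (Measure.pi fun i => gaussianReal (x' i / σ i) 1) z).toReal ^ α
          ∂(Measure.pi fun i => gaussianReal (x' i / σ i) 1)) ≤
        Real.exp (((1 : ℝ) / 2 * ∑ i, (r i) ^ 2 / (σ i) ^ 2) * α * (α - 1)) := by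
  have key := aux_pi n (fun i => x i / σ i) (fun i => x' i / σ i)
  refine ⟨by rw [key]; exact withDensity_absolutelyContinuous _ _, fun α hα => ?_⟩
  have hrn := Measure.rnDeriv_withDensity (Measure.pi fun i => gaussianReal (x' i / σ i) 1)
    (f := fun z => ENNReal.ofReal
      (∏ i, Real.exp ((x i / σ i - x' i / σ i) * z i - ((x i / σ i) ^ 2 - (x' i / σ i) ^ 2) / 2)))
    (by fun_prop)
  rw [← key] at hrn
  have e : (∫ z, ((Measure.pi fun i => gaussianReal (x i / σ i) 1).rnDeriv
          (Measure.pi fun i => gaussianReal (x' i / σ i) 1) z).toReal ^ α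
          ∂(Measure.pi fun i => gaussianReal (x' i / σ i) 1)) =
      ∫ z, ∏ i, (Real.exp ((x i / σ i - x' i / σ i) * z i
        - ((x i / σ i) ^ 2 - (x' i / σ i) ^ 2) / 2)) ^ α
          ∂(Measure.pi fun i => gaussianReal (x' i / σ i) 1) := by
    refine integral_congr_ae ?_
    filter_upwards [hrn] with z hz
    rw [hz, ENNReal.toReal_ofReal (Finset.prod_nonneg fun _ _ => (Real.exp_pos _).le),
      Real.finsetProd_rpow _ _ fun _ _ => (Real.exp_pos _).le]
  rw [e, integral_fintype_prod_eq_prod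
      (f := fun i z => (Real.exp ((x i / σ i - x' i / σ i) * z
        - ((x i / σ i) ^ 2 - (x' i / σ i) ^ 2) / 2)) ^ α)]
  simp_rw [aux_mom]
  rw [← Real.exp_sum, Real.exp_le_exp, ← Finset.sum_mul, ← Finset.sum_mul, Finset.mul_sum]
  have h1 : 0 ≤ α - 1 := by linarith
  have h0 : 0 ≤ α := by linarith
  gcongr with i _
  rw [← sub_div, div_pow]
  have h3 : (x i - x' i) ^ 2 ≤ r i ^ 2 := sq_le_sq' (by linarith [(abs_le.1 (hneighbor i)).1])
    (abs_le.1 (hneighbor i)).2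
  have h4 : (x i - x' i) ^ 2 / σ i ^ 2 ≤ r i ^ 2 / σ i ^ 2 := by gcongr
  linarith
end

section
/- Let n and k be natural numbers, let σ : Fin n → ℝ satisfy σ i > 0 for all i, let r : Fin n → ℝ be nonnegative, and let X, X' : Fin n → Fin k → ℝ satisfy, for every i, the row bound ∑_{j} |X i j − X' i j| ≤ r i. Let ρ₁ = (1/2) · ∑_{i} (r i)²/(σ i)². Let P = Measure.pi over pairs (i, j) ∈ Fin n × Fin k of gaussianReal (X i j / σ i) 1, and Q the analogous product with X'. Then P is absolutely continuous with respect to Q, and for every α > 1, ∫ (dP/dQ)^α dQ ≤ exp(ρ₁ · α · (α − 1)). -/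
open MeasureTheory ProbabilityTheory Finset

/-- Likelihood ratio of two unit-variance Gaussians. -/
noncomputable def lr (a b x : ℝ) : ℝ := Real.exp ((a - b) * x - (a ^ 2 - b ^ 2) / 2)

lemma lr_pos (a b x : ℝ) : 0 < lr a b x := Real.exp_pos _

lemma lr_rpow (a b x α : ℝ) :
    lr a b x ^ α = Real.exp ((α * (a - b)) * x) * Real.exp (-(α * (a ^ 2 - b ^ 2) / 2)) := by
  rw [lr, ← Real.exp_mul, ← Real.exp_add]
  congr 1
  ring

lemma measurable_lr (a b : ℝ) : Measurable (lr a b) := by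
  unfold lr
  fun_prop

lemma integrable_lr (a b : ℝ) : Integrable (lr a b) (gaussianReal b 1) := by
  have h : lr a b = fun x => Real.exp ((1 * (a - b)) * x) *
      Real.exp (-(1 * (a ^ 2 - b ^ 2) / 2)) := by
    ext x
    rw [← lr_rpow, Real.rpow_one]
  rw [h]
  exact (integrable_exp_mul_gaussianReal _).mul_const _

lemma integral_lr_rpow (a b α : ℝ) :
    ∫ x, lr a b x ^ α ∂(gaussianReal b 1) = Real.exp (α * (α - 1) * (a - b) ^ 2 / 2) := by
  simp_rw [lr_rpow]
  rw [integral_mul_const]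
  have h := congrFun (mgf_fun_id_gaussianReal (μ := b) (v := 1)) (α * (a - b))
  rw [mgf] at h
  rw [h, ← Real.exp_add]
  congr 1
  push_cast
  ring

lemma gaussian_eq_withDensity_s17 (a b : ℝ) :
    gaussianReal a 1 = (gaussianReal b 1).withDensity (fun x => ENNReal.ofReal (lr a b x)) := by
  rw [gaussianReal_of_var_ne_zero a one_ne_zero, gaussianReal_of_var_ne_zero b one_ne_zero,
    ← withDensity_mul _ (measurable_gaussianPDF b 1) (measurable_lr a b).ennreal_ofReal]
  congr 1
  ext x
  simp only [Pi.mul_apply, gaussianPDF]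
  rw [← ENNReal.ofReal_mul (gaussianPDFReal_nonneg _ _ _)]
  congr 1
  simp only [gaussianPDFReal, lr]
  rw [mul_assoc _ (Real.exp _) (Real.exp _), ← Real.exp_add]
  congr 2
  push_cast
  ring

lemma pi_eq_withDensity_s17 {ι : Type*} [Fintype ι] (a b : ι → ℝ) :
    (Measure.pi fun p => gaussianReal (a p) 1) =
      (Measure.pi fun p => gaussianReal (b p) 1).withDensity
        (fun z => ENNReal.ofReal (∏ p, lr (a p) (b p) (z p))) := by
  refine Measure.pi_eq fun s hs => ?_
  rw [withDensity_apply _ (MeasurableSet.univ_pi hs), Measure.restrict_pi_pi,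
    ← ofReal_integral_eq_lintegral_ofReal
      (Integrable.fintype_prod fun i => (integrable_lr (a i) (b i)).restrict)
      (Filter.Eventually.of_forall fun z => Finset.prod_nonneg fun i _ => (lr_pos _ _ _).le),
    integral_fintype_prod_eq_prod (f := fun i x => lr (a i) (b i) x),
    ENNReal.ofReal_prod_of_nonneg
      (fun i _ => integral_nonneg fun x => (lr_pos _ _ _).le)]
  refine Finset.prod_congr rfl fun i _ => ?_
  rw [gaussian_eq_withDensity_s17 (a i) (b i), withDensity_apply _ (hs i),
    ofReal_integral_eq_lintegral_ofReal (integrable_lr (a i) (b i)).restrict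
      (Filter.Eventually.of_forall fun z => (lr_pos _ _ _).le)]

lemma pi_renyi {ι : Type*} [Fintype ι] (a b : ι → ℝ) (α : ℝ) :
    ∫ z, ((Measure.pi fun p => gaussianReal (a p) 1).rnDeriv
        (Measure.pi fun p => gaussianReal (b p) 1) z).toReal ^ α
        ∂(Measure.pi fun p => gaussianReal (b p) 1) =
      Real.exp (∑ p, α * (α - 1) * (a p - b p) ^ 2 / 2) := by
  have hm : Measurable (fun z : ι → ℝ => ENNReal.ofReal (∏ p, lr (a p) (b p) (z p))) :=
    (Finset.measurable_prod _ fun p _ =>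
      (measurable_lr (a p) (b p)).comp (measurable_pi_apply p)).ennreal_ofReal
  have h := Measure.rnDeriv_withDensity (Measure.pi fun p => gaussianReal (b p) 1) hm
  rw [← pi_eq_withDensity_s17] at h
  have h2 : ∫ z, ((Measure.pi fun p => gaussianReal (a p) 1).rnDeriv
        (Measure.pi fun p => gaussianReal (b p) 1) z).toReal ^ α
        ∂(Measure.pi fun p => gaussianReal (b p) 1) =
      ∫ z, ∏ p, lr (a p) (b p) (z p) ^ α ∂(Measure.pi fun p => gaussianReal (b p) 1) := by
    refine integral_congr_ae ?_
    filter_upwards [h] with z hz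
    rw [hz, ENNReal.toReal_ofReal (Finset.prod_nonneg fun i _ => (lr_pos _ _ _).le),
      Real.finsetProd_rpow _ _ (fun i _ => (lr_pos _ _ _).le)]
  rw [h2, integral_fintype_prod_eq_prod (f := fun i x => lr (a i) (b i) x ^ α), Real.exp_sum]
  exact Finset.prod_congr rfl fun i _ => integral_lr_rpow _ _ _

theorem adsbpc_multi_publisher_zCDP (n k : ℕ) (σ : Fin n → ℝ) (hσ : ∀ i, 0 < σ i)
    (r : Fin n → ℝ) (hr : ∀ i, 0 ≤ r i)
    (X X' : Fin n → Fin k → ℝ)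
    (hneighbor : ∀ i, ∑ j, |X i j - X' i j| ≤ r i) :
    (Measure.pi fun p : Fin n × Fin k => gaussianReal (X p.1 p.2 / σ p.1) 1) ≪
      (Measure.pi fun p : Fin n × Fin k => gaussianReal (X' p.1 p.2 / σ p.1) 1) ∧
    ∀ α : ℝ, 1 < α →
      (∫ z, ((Measure.pi fun p : Fin n × Fin k =>
            gaussianReal (X p.1 p.2 / σ p.1) 1).rnDeriv
          (Measure.pi fun p : Fin n × Fin k =>
            gaussianReal (X' p.1 p.2 / σ p.1) 1) z).toReal ^ α
          ∂(Measure.pi fun p : Fin n × Fin k =>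
            gaussianReal (X' p.1 p.2 / σ p.1) 1)) ≤
        Real.exp (((1 : ℝ) / 2 * ∑ i, (r i) ^ 2 / (σ i) ^ 2) * α * (α - 1)) := by
  refine ⟨?_, fun α hα => ?_⟩
  · rw [pi_eq_withDensity_s17 (fun p : Fin n × Fin k => X p.1 p.2 / σ p.1)
      (fun p : Fin n × Fin k => X' p.1 p.2 / σ p.1)]
    exact withDensity_absolutelyContinuous _ _
  · rw [pi_renyi (fun p : Fin n × Fin k => X p.1 p.2 / σ p.1)
      (fun p : Fin n × Fin k => X' p.1 p.2 / σ p.1) α]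
    apply Real.exp_le_exp.mpr
    rw [Fintype.sum_prod_type, Finset.mul_sum, Finset.sum_mul, Finset.sum_mul]
    refine Finset.sum_le_sum fun i _ => ?_
    have h1 : ∑ j, (X i j - X' i j) ^ 2 ≤ r i ^ 2 := by
      calc ∑ j, (X i j - X' i j) ^ 2 = ∑ j, |X i j - X' i j| ^ 2 := by simp only [sq_abs]
        _ ≤ (∑ j, |X i j - X' i j|) ^ 2 :=
          Finset.sum_sq_le_sq_sum_of_nonneg fun _ _ => abs_nonneg _
        _ ≤ r i ^ 2 :=
          pow_le_pow_left₀ (Finset.sum_nonneg fun _ _ => abs_nonneg _) (hneighbor i) 2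
    have h2 : ∑ j, α * (α - 1) * (X i j / σ i - X' i j / σ i) ^ 2 / 2 =
        α * (α - 1) / (2 * σ i ^ 2) * ∑ j, (X i j - X' i j) ^ 2 := by
      rw [Finset.mul_sum]
      refine Finset.sum_congr rfl fun j _ => ?_
      have := (hσ i).ne'
      field_simp
    have h3 : 0 ≤ α * (α - 1) / (2 * σ i ^ 2) :=
      div_nonneg (mul_nonneg (by linarith) (by linarith)) (by positivity)
    calc _ = _ := h2
      _ ≤ α * (α - 1) / (2 * σ i ^ 2) * r i ^ 2 := mul_le_mul_of_nonneg_left h1 h3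
      _ = _ := by
        have := (hσ i).ne'
        field_simp
end
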